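/- In the pushout setup along a closed inclusion, for every B ⊆ Z the interior operator of e satisfies i_e(B) = g(i'(B_X)) ⊔ j(i_d(B_Y) ∖ f(A ∩ c((X∖A) ∖ B_X))), where B_Y = j⁻¹(B) ⊆ Y, B_X = {x ∈ X∖A | g(x) ∈ B} ⊆ X∖A, i_e(B) = Z ∖ e(Z∖B), i_d is the interior operator of d, and i' is the interior operator of the subspace closure c'(S) = (X∖A) ∩ c(S) on X∖A (so i'(S) = (X∖A) ∖ c'((X∖A)∖S)). -/

import Mathlib

/-- A Čech closure operator on `X`. -/
def IsCechClosure {X : Type*} (c : Set X → Set X) : Prop :=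
  c ∅ = ∅ ∧ (∀ A : Set X, A ⊆ c A) ∧ (∀ A B : Set X, c (A ∪ B) = c A ∪ c B)

/-- The interior operator associated to a closure operator: `i_c(A) = (c(Aᶜ))ᶜ`. -/
def intOp {X : Type*} (c : Set X → Set X) (A : Set X) : Set X := (c Aᶜ)ᶜ

theorem IsCechClosure.mono {X : Type*} {c : Set X → Set X} (hc : IsCechClosure c)
    {S T : Set X} (h : S ⊆ T) : c S ⊆ c T := by
  rw [← Set.union_eq_self_of_subset_left h, hc.2.2]
  exact Set.subset_union_left

/-- In the pushout of closure spaces along a closed inclusion `A ↪ X` and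
`f : A → Y` (on `Z = Y ⊕ (X∖A)`, with pushout closure
`e(B) = j(d(j⁻¹ B)) ∪ g(c(g⁻¹ B))`), the interior operator of `e` satisfies
`i_e(B) = g(i'(B_X)) ∪ j(i_d(B_Y) ∖ f(A ∩ c((X∖A) ∖ B_X)))`, where
`B_Y = j⁻¹(B)`, `B_X = {x ∈ X∖A | g x ∈ B}`, `i_d` is the interior of `d`, and
`i'` is the interior of the subspace closure `c'(S) = (X∖A) ∩ c(S)` on `X∖A`. -/
theorem pushout_interior_along_closed_inclusion {X Y : Type*}
    (c : Set X → Set X) (d : Set Y → Set Y)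
    (hc : IsCechClosure c) (hd : IsCechClosure d)
    (A : Set X) (hA : c A = A) (f : X → Y)
    (hf : ∀ S : Set X, S ⊆ A → f '' (c S) ⊆ d (f '' S))
    (j : Y → Y ⊕ {x : X // x ∉ A}) (hj : j = Sum.inl)
    (g : X → Y ⊕ {x : X // x ∉ A})
    (hg₁ : ∀ x : X, x ∈ A → g x = Sum.inl (f x))
    (hg₂ : ∀ (x : X) (h : x ∉ A), g x = Sum.inr ⟨x, h⟩)
    (e : Set (Y ⊕ {x : X // x ∉ A}) → Set (Y ⊕ {x : X // x ∉ A}))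
    (he : ∀ B, e B = j '' (d (j ⁻¹' B)) ∪ g '' (c (g ⁻¹' B))) :
    ∀ B : Set (Y ⊕ {x : X // x ∉ A}),
      (e Bᶜ)ᶜ =
        g '' (Aᶜ \ (Aᶜ ∩ c (Aᶜ \ {x : X | x ∉ A ∧ g x ∈ B}))) ∪
          j '' (intOp d (j ⁻¹' B) \
            f '' (A ∩ c (Aᶜ \ {x : X | x ∉ A ∧ g x ∈ B}))) := by
  intro B
  subst hj
  set T : Set X := Aᶜ \ {x : X | x ∉ A ∧ g x ∈ B} with hT
  set S : Set X := A ∩ g ⁻¹' Bᶜ with hS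
  have hST : g ⁻¹' Bᶜ = S ∪ T := by
    ext x
    simp only [hS, hT, Set.mem_union, Set.mem_inter_iff, Set.mem_sdiff, Set.mem_compl_iff,
      Set.mem_preimage, Set.mem_ofPred_eq]
    tauto
  have hSA : c S ⊆ A := hA ▸ hc.mono Set.inter_subset_left
  have hfS : ∀ x ∈ c S, f x ∈ d (Sum.inl ⁻¹' Bᶜ) := by
    intro x hx
    refine hd.mono ?_ (hf S Set.inter_subset_left ⟨x, hx, rfl⟩)
    rintro _ ⟨a, ⟨ha, haB⟩, rfl⟩
    simpa only [Set.mem_preimage, hg₁ a ha] using haB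
  have hinl : ∀ x y, g x = Sum.inl y ↔ x ∈ A ∧ f x = y := by
    intro x y
    by_cases hx : x ∈ A
    · simp [hg₁ x hx, hx]
    · simp [hg₂ x hx, hx]
  have hinr : ∀ x w, g x = Sum.inr w ↔ x = w.1 := by
    rintro x ⟨w, hw⟩
    by_cases hx : x ∈ A
    · simp only [hg₁ x hx, reduceCtorEq, false_iff]
      rintro rfl
      exact hw hx
    · simp [hg₂ x hx]
  rw [he, hST, hc.2.2]
  ext (y | ⟨w, hw⟩)
  · simp only [Set.mem_compl_iff, Set.mem_union, Set.mem_image, Set.mem_sdiff, Set.mem_inter_iff,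
      hinl, intOp, Sum.inl.injEq, exists_eq_right, ← Set.preimage_compl]
    constructor
    · intro h
      refine Or.inr ⟨fun hy => h (Or.inl hy), ?_⟩
      rintro ⟨x, ⟨hxA, hxT⟩, rfl⟩
      exact h (Or.inr ⟨x, Or.inr hxT, hxA, rfl⟩)
    · rintro (⟨x, ⟨hx, -⟩, hxA, -⟩ | ⟨hy, hn⟩)
      · exact absurd hxA hx
      · rintro (h | ⟨x, hx | hx, hxA, rfl⟩)
        · exact hy h
        · exact hy (hfS x hx)
        · exact hn ⟨x, ⟨hxA, hx⟩, rfl⟩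
  · have hwS : w ∉ c S := fun h => hw (hSA h)
    simp [hinr, hw, hwS]
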